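/- arXiv:2301.05542 — 4 statements merged into one kernel-verified Lean document; each statement's English description precedes it below -/
import Mathlib

section
/- Let R and E be commutative rings, q : E → R and z : R → E ring homomorphisms with q(z(a)) = a for all a ∈ R, and let D : E → E be an additive map such that for all x, y ∈ E and a ∈ R: D(xy) = z(q(x))·D(y) + z(q(y))·D(x), q(D(x)) = 0, D(z(a)) = 0, and D(D(x)) = D(x). Assume further the following universal property (Rosický universality of the lift): for every commutative ring S, every ring homomorphism g : S → R, and every additive map D' : S → E satisfying D'(st) = z(g(s))·D'(t) + z(g(t))·D'(s) and q(D'(s)) = 0 for all s, t ∈ S, there exists a unique ring homomorphism h : S → E with q ∘ h = g and D ∘ h = D'. Let K := ker(q), regarded as an R-module via the action a • k = z(a)·k. Then the map β : E → TrivSqZeroExt R K defined by β(x) = (q(x), D(x)) is a ring isomorphism, with inverse given by (a, k) ↦ z(a) + k. -/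
open TrivSqZeroExt

/-- The ring-level unfolding of a differential bundle with negatives
over `R` in the tangent category of commutative rings: given commutative rings `R, E`,
ring homomorphisms `q : E → R`, `z : R → E` with `q ∘ z = id`, and an additive map
`D : E → E` satisfying the differential-bundle identities and the Rosický universality
of the lift, the map `β x = (q x, D x)` is a ring isomorphism from `E` to the trivial
square-zero extension of `R` by `K = ker q` (an `R`-module via `a • k = z a * k`),
with inverse `(a, k) ↦ z a + k`. -/
theorem diff_bundle_iso_trivSqZeroExt_of_ker (R E : Type u) [CommRing R] [CommRing E]
    (q : E →+* R) (z : R →+* E) (hqz : ∀ a : R, q (z a) = a)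
    (D : E →+ E)
    (hmul : ∀ x y : E, D (x * y) = z (q x) * D y + z (q y) * D x)
    (hqD : ∀ x : E, q (D x) = 0)
    (hDz : ∀ a : R, D (z a) = 0)
    (hDD : ∀ x : E, D (D x) = D x)
    (univ : ∀ (S : Type u) [CommRing S] (g : S →+* R) (D' : S →+ E),
      (∀ s t : S, D' (s * t) = z (g s) * D' t + z (g t) * D' s) →
      (∀ s : S, q (D' s) = 0) →
      ∃! h : S →+* E, (∀ s : S, q (h s) = g s) ∧ (∀ s : S, D (h s) = D' s)) :
    letI : Algebra R E := z.toAlgebra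
    letI : Module Rᵐᵒᵖ (RingHom.ker q) :=
      Module.compHom _ ((RingHom.id R).fromOpposite fun x y => mul_comm x y)
    letI : IsCentralScalar R (RingHom.ker q) := ⟨fun _ _ => rfl⟩
    ∃ β : E ≃+* TrivSqZeroExt R (RingHom.ker q),
      (∀ x : E, (β x).fst = q x ∧ ((β x).snd : E) = D x) ∧
      (∀ (a : R) (k : RingHom.ker q), β.symm (inl a + inr k) = z a + (k : E)) := by
  letI : Algebra R E := z.toAlgebra
  letI : Module Rᵐᵒᵖ (RingHom.ker q) :=
    Module.compHom _ ((RingHom.id R).fromOpposite fun x y => mul_comm x y)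
  letI : IsCentralScalar R (RingHom.ker q) := ⟨fun _ _ => rfl⟩
  have coe_smul (a : R) (k : RingHom.ker q) : ((a • k : RingHom.ker q) : E) = z a * k := rfl
  have coe_op_smul (a : R) (k : RingHom.ker q) :
      ((MulOpposite.op a • k : RingHom.ker q) : E) = z a * k := rfl
  have D_one : D 1 = 0 := by simpa using hDz 1
  let β : E →+* TrivSqZeroExt R (RingHom.ker q) :=
    { toFun x := (q x, ⟨D x, hqD x⟩)
      map_one' := TrivSqZeroExt.ext (map_one q) (Subtype.ext D_one)
      map_zero' := TrivSqZeroExt.ext (map_zero q) (Subtype.ext (map_zero D))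
      map_add' x y := TrivSqZeroExt.ext (map_add q x y) (Subtype.ext (map_add D x y))
      map_mul' x y := TrivSqZeroExt.ext (map_mul q x y) (Subtype.ext (hmul x y)) }
  obtain ⟨h, ⟨hq, hD⟩, -⟩ := univ (TrivSqZeroExt R (RingHom.ker q))
    (fstHom R R (RingHom.ker q)).toRingHom
    { toFun s := (s.snd : E)
      map_zero' := rfl
      map_add' _ _ := rfl }
    (fun s t => by
      change ((s * t).snd : E) = z s.fst * t.snd + z t.fst * s.snd
      rw [snd_mul, Submodule.coe_add, coe_smul, coe_op_smul])
    (fun s => s.snd.2)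
  have left_inv : h.comp β = RingHom.id E :=
    (univ E q D hmul hqD).unique
      ⟨fun x => hq (β x), fun x => hD (β x)⟩ ⟨fun _ => rfl, fun _ => rfl⟩
  have right_inv : β.comp h = RingHom.id _ :=
    RingHom.ext fun s => TrivSqZeroExt.ext (hq s) (Subtype.ext (hD s))
  have β_injective : Function.Injective β :=
    Function.LeftInverse.injective (g := h) (RingHom.congr_fun left_inv)
  have D_eq_self (k : RingHom.ker q) : D k = k :=
    β_injective <| TrivSqZeroExt.ext ((hqD k).trans k.2.symm) (Subtype.ext (hDD k))
  refine ⟨RingEquiv.ofRingHom β h right_inv left_inv, fun x => ⟨rfl, rfl⟩, fun a k => ?_⟩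
  rw [RingEquiv.symm_apply_eq]
  refine TrivSqZeroExt.ext ?_ (Subtype.ext ?_)
  · change a + 0 = q (z a + k)
    rw [map_add, hqz, RingHom.mem_ker.mp k.2]
  · change ((0 + k : RingHom.ker q) : E) = D (z a + k)
    rw [map_add, hDz, D_eq_self, zero_add, zero_add]
end

section
/- For a commutative ring R and an R-module M, there is a unique ring homomorphism λ : TrivSqZeroExt R M → DualNumber (TrivSqZeroExt R M) such that λ(inl(a)) = inl(inl(a)) for all a ∈ R and λ(inr(m)) = inr(inr(m)) for all m ∈ M; explicitly, λ(a, m) = ((a, 0), (0, m)). Moreover, fst(λ(x)) = inl(fst(x)) for all x ∈ TrivSqZeroExt R M. -/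
open TrivSqZeroExt

/-- The lift `a + mε ↦ a + mεε'` of the differential bundle `TrivSqZeroExt R M` over `R`. -/
def trivSqZeroExtLift (R M : Type*) [CommRing R] [AddCommGroup M]
    [Module R M] [Module Rᵐᵒᵖ M] [IsCentralScalar R M] :
    TrivSqZeroExt R M →+* DualNumber (TrivSqZeroExt R M) where
  toFun x := inl (inl x.fst) + inr (inr x.snd)
  map_one' := by ext <;> simp
  map_zero' := by ext <;> simp
  map_mul' x y := by ext <;> simp
  map_add' x y := by ext <;> simp

/-- For a commutative ring `R` and an `R`-module `M`, there is a unique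
ring homomorphism `λ : TrivSqZeroExt R M → DualNumber (TrivSqZeroExt R M)` with
`λ (inl a) = inl (inl a)` and `λ (inr m) = inr (inr m)`; explicitly
`λ (a, m) = ((a, 0), (0, m))`, i.e. `λ (inl a + inr m) = inl (inl a) + inr (inr m)`.
Moreover `fst (λ x) = inl (fst x)` for all `x`. -/
theorem lift_of_trivSqZeroExt_exists_unique (R M : Type*) [CommRing R] [AddCommGroup M]
    [Module R M] [Module Rᵐᵒᵖ M] [IsCentralScalar R M] :
    ∃ l : TrivSqZeroExt R M →+* DualNumber (TrivSqZeroExt R M),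
      ((∀ a : R, l (inl a) = inl (inl a)) ∧ (∀ m : M, l (inr m) = inr (inr m))) ∧
      (∀ l' : TrivSqZeroExt R M →+* DualNumber (TrivSqZeroExt R M),
        ((∀ a : R, l' (inl a) = inl (inl a)) ∧ (∀ m : M, l' (inr m) = inr (inr m))) →
          l' = l) ∧
      (∀ (a : R) (m : M), l (inl a + inr m) = inl (inl a) + inr (inr m)) ∧
      (∀ x : TrivSqZeroExt R M, (l x).fst = inl x.fst) := by
  refine ⟨trivSqZeroExtLift R M, ⟨fun a => ?_, fun m => ?_⟩, fun l' ⟨hl, hr⟩ => ?_,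
    fun a m => ?_, fun x => ?_⟩
  · simp [trivSqZeroExtLift]
  · simp [trivSqZeroExtLift]
  · refine RingHom.ext fun x => ?_
    rw [← inl_fst_add_inr_snd_eq x, map_add, hl, hr]
    simp [trivSqZeroExtLift]
  · simp [trivSqZeroExtLift]
  · simp [trivSqZeroExtLift]
end

section
/- Let R be a commutative ring, M an R-module, E := TrivSqZeroExt R M, q := fst : E → R the projection ring homomorphism, and λ : E → DualNumber E the ring homomorphism λ(a, m) = ((a, 0), (0, m)). Then for every commutative ring S and all ring homomorphisms f : S → DualNumber E and g : S → R satisfying, for all s ∈ S, (i) fst(f(s)) = inl(g(s)) in E and (ii) q(snd(f(s))) = 0 (equivalently, applying q to both components of f(s) yields (g(s), 0) in DualNumber R), there exists a unique ring homomorphism h : S → E such that λ ∘ h = f and q ∘ h = g. -/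
open TrivSqZeroExt

/-- Rosický universality for the differential bundle
`q = fst : E → R`, `E = TrivSqZeroExt R M`, with lift `l : E → DualNumber E`,
`l (a, m) = ((a, 0), (0, m))`: for every commutative ring `S` and ring homomorphisms
`f : S → DualNumber E`, `g : S → R` with `fst (f s) = inl (g s)` and
`fst (snd (f s)) = 0`, there is a unique ring homomorphism `h : S → E` with
`l ∘ h = f` and `fst ∘ h = g`. -/
theorem rosicky_universality_trivSqZeroExt (R M : Type u) [CommRing R] [AddCommGroup M]
    [Module R M] [Module Rᵐᵒᵖ M] [IsCentralScalar R M]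
    (l : TrivSqZeroExt R M →+* DualNumber (TrivSqZeroExt R M))
    (hl : ∀ x : TrivSqZeroExt R M, l x = inl (inl x.fst) + inr (inr x.snd)) :
    ∀ (S : Type v) [CommRing S] (f : S →+* DualNumber (TrivSqZeroExt R M)) (g : S →+* R),
      (∀ s : S, (f s).fst = inl (g s)) →
      (∀ s : S, ((f s).snd).fst = 0) →
      ∃! h : S →+* TrivSqZeroExt R M,
        (∀ s : S, l (h s) = f s) ∧ (∀ s : S, (h s).fst = g s) := by
  intro S _ f g hfst hsnd
  have l_injective : Function.Injective l := by
    intro x y hxy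
    rw [hl, hl] at hxy
    refine TrivSqZeroExt.ext ?_ ?_
    · simpa using congrArg (fun z => z.fst.fst) hxy
    · simpa using congrArg (fun z => z.snd.snd) hxy
  let k : S → TrivSqZeroExt R M := fun s => (g s, (f s).snd.snd)
  have k_fst (s : S) : (k s).fst = g s := rfl
  have k_snd (s : S) : (k s).snd = (f s).snd.snd := rfl
  have l_k (s : S) : l (k s) = f s := by
    rw [hl, k_fst, k_snd]
    refine TrivSqZeroExt.ext ?_ (TrivSqZeroExt.ext ?_ ?_)
    · simp [hfst]
    · simp [hsnd]
    · simp
  refine ⟨{ toFun := k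
            map_one' := l_injective (by simp only [l_k, map_one])
            map_mul' := fun s t => l_injective (by simp only [l_k, map_mul])
            map_zero' := l_injective (by simp only [l_k, map_zero])
            map_add' := fun s t => l_injective (by simp only [l_k, map_add]) },
    ⟨l_k, k_fst⟩, ?_⟩
  rintro h ⟨h_lift, -⟩
  exact RingHom.ext fun s => l_injective ((h_lift s).trans (l_k s).symm)
end

section
/- For commutative rings A and B, there is an isomorphism of (A ⊗[ℤ] B)-modules Ω[(A ⊗[ℤ] B)⁄ℤ] ≅ (B ⊗[ℤ] Ω[A⁄ℤ]) × (A ⊗[ℤ] Ω[B⁄ℤ]), where B ⊗[ℤ] Ω[A⁄ℤ] and A ⊗[ℤ] Ω[B⁄ℤ] carry their natural (A ⊗[ℤ] B)-module structures. (This is the decomposition Ω(R ⊗ S) ≅ R ⊗ Ω(S) ⊕ S ⊗ Ω(R) underlying the Cartesian structure of the tangent category of affine schemes.) -/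
open TensorProduct

/-- The natural `(A ⊗[ℤ] B)`-module structure on `B ⊗[ℤ] Ω[A⁄ℤ]`, where `a ⊗ b` acts
by multiplication by `b` on the left factor and by `a` on the Kähler differentials. -/
noncomputable def tensorKaehlerModuleLeft (A B : Type*) [CommRing A] [CommRing B] :
    Module (A ⊗[ℤ] B) (B ⊗[ℤ] KaehlerDifferential ℤ A) :=
  Module.compHom _
    (((Module.endTensorEndAlgHom (R := ℤ) (S := ℤ) (A := ℤ)
        (M := B) (N := KaehlerDifferential ℤ A)).comp
      ((Algebra.TensorProduct.map (Algebra.lsmul ℤ ℤ B (A := B))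
          (Algebra.lsmul ℤ ℤ (KaehlerDifferential ℤ A) (A := A))).comp
        (Algebra.TensorProduct.comm ℤ A B).toAlgHom)).toRingHom)

/-- The natural `(A ⊗[ℤ] B)`-module structure on `A ⊗[ℤ] Ω[B⁄ℤ]`, where `a ⊗ b` acts
by multiplication by `a` on the left factor and by `b` on the Kähler differentials. -/
noncomputable def tensorKaehlerModuleRight (A B : Type*) [CommRing A] [CommRing B] :
    Module (A ⊗[ℤ] B) (A ⊗[ℤ] KaehlerDifferential ℤ B) :=
  Module.compHom _
    (((Module.endTensorEndAlgHom (R := ℤ) (S := ℤ) (A := ℤ)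
        (M := A) (N := KaehlerDifferential ℤ B)).comp
      (Algebra.TensorProduct.map (Algebra.lsmul ℤ ℤ A (A := A))
        (Algebra.lsmul ℤ ℤ (KaehlerDifferential ℤ B) (A := B)))).toRingHom)

section

/-- If derivations `δ₁ : C → M` and `δ₂ : C → N` are such that `M` is spanned by the values of `δ₁`
on the kernel of `δ₂`, and conversely, then linear maps `φ₁`, `φ₂` with `φ₁ ∘ δ₁ + φ₂ ∘ δ₂ = D`
identify `Ω[C⁄R]` with `M × N`. -/
noncomputable def KaehlerDifferential.equivProdOfDerivations {R C M N : Type*} [CommRing R]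
    [CommRing C] [Algebra R C]
    [AddCommGroup M] [Module R M] [Module C M] [IsScalarTower R C M]
    [AddCommGroup N] [Module R N] [Module C N] [IsScalarTower R C N]
    (δ₁ : Derivation R C M) (δ₂ : Derivation R C N)
    (φ₁ : M →ₗ[C] KaehlerDifferential R C) (φ₂ : N →ₗ[C] KaehlerDifferential R C)
    (hφ : ∀ c, φ₁ (δ₁ c) + φ₂ (δ₂ c) = KaehlerDifferential.D R C c)
    (h₁ : ⊤ ≤ Submodule.span C (δ₁ '' {c | δ₂ c = 0}))
    (h₂ : ⊤ ≤ Submodule.span C (δ₂ '' {c | δ₁ c = 0})) :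
    KaehlerDifferential R C ≃ₗ[C] M × N :=
  LinearEquiv.ofLinearMap
    (δ₁.liftKaehlerDifferential.prod δ₂.liftKaehlerDifferential) (φ₁.coprod φ₂)
    (by
      apply LinearMap.prod_ext
      · refine LinearMap.ext_on (top_le_iff.mp h₁) ?_
        rintro _ ⟨c, hc, rfl⟩
        have hD : φ₁ (δ₁ c) = KaehlerDifferential.D R C c := by
          rw [← hφ, show δ₂ c = 0 from hc, map_zero, add_zero]
        simpa [hD] using hc
      · refine LinearMap.ext_on (top_le_iff.mp h₂) ?_
        rintro _ ⟨c, hc, rfl⟩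
        have hD : φ₂ (δ₂ c) = KaehlerDifferential.D R C c := by
          rw [← hφ, show δ₁ c = 0 from hc, map_zero, zero_add]
        simpa [hD] using hc)
    (by
      apply Derivation.liftKaehlerDifferential_unique
      ext c
      simp [hφ])

/-- The map induced on Kähler differentials by an algebra homomorphism. -/
noncomputable def AlgHom.kaehlerMap {R A C : Type*} [CommRing R] [CommRing A] [Algebra R A]
    [CommRing C] [Algebra R C] (f : A →ₐ[R] C) :
    KaehlerDifferential R A →+ KaehlerDifferential R C :=
  letI := f.toRingHom.toAlgebra
  haveI : IsScalarTower R A C := .of_algebraMap_eq' f.comp_algebraMap.symm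
  (KaehlerDifferential.map R R A C).toAddMonoidHom

theorem AlgHom.kaehlerMap_D {R A C : Type*} [CommRing R] [CommRing A] [Algebra R A]
    [CommRing C] [Algebra R C] (f : A →ₐ[R] C) (a : A) :
    f.kaehlerMap (KaehlerDifferential.D R A a) = KaehlerDifferential.D R C (f a) :=
  let := f.toRingHom.toAlgebra
  have : IsScalarTower R A C := .of_algebraMap_eq' f.comp_algebraMap.symm
  KaehlerDifferential.map_D R R A C a

theorem AlgHom.kaehlerMap_smul {R A C : Type*} [CommRing R] [CommRing A] [Algebra R A]
    [CommRing C] [Algebra R C] (f : A →ₐ[R] C) (a : A) (ω : KaehlerDifferential R A) :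
    f.kaehlerMap (a • ω) = f a • f.kaehlerMap ω :=
  let := f.toRingHom.toAlgebra
  have : IsScalarTower R A C := .of_algebraMap_eq' f.comp_algebraMap.symm
  ((KaehlerDifferential.map R R A C).map_smul a ω).trans (algebraMap_smul C a _).symm

/-- `Ω[A⁄R]` is generated under addition by the elements `a • da'`. -/
theorem KaehlerDifferential.induction_smul_D {R A : Type*} [CommRing R] [CommRing A] [Algebra R A]
    {P : KaehlerDifferential R A → Prop} (zero : P 0)
    (add : ∀ ω η, P ω → P η → P (ω + η))
    (smul_D : ∀ a a' : A, P (a • KaehlerDifferential.D R A a'))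
    (ω : KaehlerDifferential R A) : P ω := by
  obtain ⟨x, rfl⟩ := KaehlerDifferential.tensorProductTo_surjective R A ω
  induction x with
  | zero => simpa using zero
  | add x y hx hy => simpa using add _ _ hx hy
  | tmul a a' =>
    rw [(KaehlerDifferential.D R A).tensorProductTo_tmul]
    exact smul_D a a'

/-- `AddCommGroup.intIsScalarTower` for an arbitrary `ℤ`-algebra structure on `C`. -/
theorem isScalarTower_int_of_algebra {C M : Type*} [CommRing C] [Algebra ℤ C] [AddCommGroup M]
    [Module C M] : @IsScalarTower ℤ C M Algebra.toSMul _ _ :=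
  .of_algebraMap_smul fun n m ↦ by
    rw [eq_intCast (algebraMap ℤ C), Int.cast_smul_eq_zsmul]

variable {A B : Type*} [CommRing A] [CommRing B]

/-- The Leibniz rule on a tensor product of algebras may be checked on pure tensors. -/
theorem tensorProduct_leibniz {M : Type*} [AddCommGroup M] [Module (A ⊗[ℤ] B) M]
    (d : A ⊗[ℤ] B →+ M)
    (h : ∀ a b a' b', d ((a * a') ⊗ₜ (b * b')) =
      (a ⊗ₜ[ℤ] b) • d (a' ⊗ₜ b') + (a' ⊗ₜ[ℤ] b') • d (a ⊗ₜ b)) (x y : A ⊗[ℤ] B) :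
    d (x * y) = x • d y + y • d x := by
  have zero_smul' (m : M) : (0 : A ⊗[ℤ] B) • m = 0 := zero_smul (A ⊗[ℤ] B) m
  induction x with
  | zero => rw [zero_mul, d.map_zero, smul_zero, zero_smul', add_zero]
  | add x x' hx hx' =>
    rw [add_mul, d.map_add, hx, hx', d.map_add, smul_add, add_smul]
    abel
  | tmul a b =>
    induction y with
    | zero => rw [mul_zero, d.map_zero, smul_zero, zero_smul', add_zero]
    | add y y' hy hy' =>
      rw [mul_add, d.map_add, hy, hy', d.map_add, smul_add, add_smul]
      abel
    | tmul a' b' => rw [Algebra.TensorProduct.tmul_mul_tmul, h]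

/-- Linearity over a tensor product of algebras may be checked on pure tensors. -/
theorem tensorProduct_map_smul {M N : Type*} [AddCommGroup M] [Module (A ⊗[ℤ] B) M]
    [AddCommGroup N] [Module (A ⊗[ℤ] B) N] (f : M →+ N)
    (h : ∀ (a : A) (b : B) (m : M), f ((a ⊗ₜ[ℤ] b) • m) = (a ⊗ₜ[ℤ] b) • f m)
    (r : A ⊗[ℤ] B) (m : M) :
    f (r • m) = r • f m := by
  induction r with
  | zero =>
    have hm : (0 : A ⊗[ℤ] B) • m = 0 := zero_smul (A ⊗[ℤ] B) m
    have hfm : (0 : A ⊗[ℤ] B) • f m = 0 := zero_smul (A ⊗[ℤ] B) (f m)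
    rw [hm, hfm, f.map_zero]
  | add r r' hr hr' => rw [add_smul, add_smul, f.map_add, hr, hr']
  | tmul a b => exact h a b m

/-- For algebra homomorphisms `f : A → C` and `g : B → C`, the map `b ⊗ ω ↦ g b • f ω`. -/
noncomputable def tensorKaehlerDesc {C : Type*} [CommRing C] [Algebra ℤ C] (f : A →ₐ[ℤ] C)
    (g : B →ₐ[ℤ] C) : B ⊗[ℤ] KaehlerDifferential ℤ A →+ KaehlerDifferential ℤ C :=
  TensorProduct.liftAddHom
    ((smulAddHom C (KaehlerDifferential ℤ C)).compl₂ f.kaehlerMap |>.comp (g : B →+ C))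
    fun n b ω ↦ by simp [map_zsmul, mul_smul, Int.cast_smul_eq_zsmul]

theorem tensorKaehlerDesc_tmul {C : Type*} [CommRing C] [Algebra ℤ C] (f : A →ₐ[ℤ] C)
    (g : B →ₐ[ℤ] C) (b : B) (ω : KaehlerDifferential ℤ A) :
    tensorKaehlerDesc f g (b ⊗ₜ ω) = g b • f.kaehlerMap ω :=
  rfl

theorem tensorKaehlerDesc_tmul_D {C : Type*} [CommRing C] [Algebra ℤ C] (f : A →ₐ[ℤ] C)
    (g : B →ₐ[ℤ] C) (b : B) (a : A) :
    tensorKaehlerDesc f g (b ⊗ₜ KaehlerDifferential.D ℤ A a) =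
      g b • KaehlerDifferential.D ℤ C (f a) := by
  rw [tensorKaehlerDesc_tmul, AlgHom.kaehlerMap_D]

theorem tensorKaehlerDesc_tmul_smul {C : Type*} [CommRing C] [Algebra ℤ C] (f : A →ₐ[ℤ] C)
    (g : B →ₐ[ℤ] C) (b x : B) (a : A) (ω : KaehlerDifferential ℤ A) :
    tensorKaehlerDesc f g ((b * x) ⊗ₜ (a • ω)) =
      (f a * g b) • tensorKaehlerDesc f g (x ⊗ₜ ω) := by
  rw [tensorKaehlerDesc_tmul, tensorKaehlerDesc_tmul, AlgHom.kaehlerMap_smul, smul_smul,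
    smul_smul, map_mul]
  congr 1
  ring

attribute [local instance] tensorKaehlerModuleLeft tensorKaehlerModuleRight

theorem tmul_smul_tmul_kaehler_left (a : A) (b x : B) (ω : KaehlerDifferential ℤ A) :
    (a ⊗ₜ[ℤ] b) • (x ⊗ₜ[ℤ] ω) = (b * x) ⊗ₜ[ℤ] (a • ω) :=
  rfl

theorem tmul_smul_tmul_kaehler_right (a x : A) (b : B) (ω : KaehlerDifferential ℤ B) :
    (a ⊗ₜ[ℤ] b) • (x ⊗ₜ[ℤ] ω) = (a * x) ⊗ₜ[ℤ] (b • ω) :=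
  rfl

variable (A B)

/-- The derivation `a ⊗ b ↦ b ⊗ da`. -/
noncomputable def tensorDerivationLeft :
    Derivation ℤ (A ⊗[ℤ] B) (B ⊗[ℤ] KaehlerDifferential ℤ A) :=
  let d : A ⊗[ℤ] B →+ B ⊗[ℤ] KaehlerDifferential ℤ A :=
    ((KaehlerDifferential.D ℤ A).toLinearMap.lTensor B ∘ₗ
      (TensorProduct.comm ℤ A B).toLinearMap).toAddMonoidHom
  Derivation.mk' d.toIntLinearMap <| tensorProduct_leibniz d fun a b a' b' ↦ by
    change (b * b') ⊗ₜ KaehlerDifferential.D ℤ A (a * a') =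
      (b * b') ⊗ₜ (a • KaehlerDifferential.D ℤ A a') +
        (b' * b) ⊗ₜ (a' • KaehlerDifferential.D ℤ A a)
    rw [Derivation.leibniz, TensorProduct.tmul_add, mul_comm b' b]

/-- The derivation `a ⊗ b ↦ a ⊗ db`. -/
noncomputable def tensorDerivationRight :
    Derivation ℤ (A ⊗[ℤ] B) (A ⊗[ℤ] KaehlerDifferential ℤ B) :=
  let d : A ⊗[ℤ] B →+ A ⊗[ℤ] KaehlerDifferential ℤ B :=
    ((KaehlerDifferential.D ℤ B).toLinearMap.lTensor A).toAddMonoidHom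
  Derivation.mk' d.toIntLinearMap <| tensorProduct_leibniz d fun a b a' b' ↦ by
    change (a * a') ⊗ₜ KaehlerDifferential.D ℤ B (b * b') =
      (a * a') ⊗ₜ (b • KaehlerDifferential.D ℤ B b') +
        (a' * a) ⊗ₜ (b' • KaehlerDifferential.D ℤ B b)
    rw [Derivation.leibniz, TensorProduct.tmul_add, mul_comm a' a]

/-- The map `b ⊗ da ↦ (1 ⊗ b) • d(a ⊗ 1)`. -/
noncomputable def kaehlerOfTensorLeft :
    B ⊗[ℤ] KaehlerDifferential ℤ A →ₗ[A ⊗[ℤ] B] KaehlerDifferential ℤ (A ⊗[ℤ] B) :=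
  let f : B ⊗[ℤ] KaehlerDifferential ℤ A →+ KaehlerDifferential ℤ (A ⊗[ℤ] B) :=
    tensorKaehlerDesc Algebra.TensorProduct.includeLeft
      Algebra.TensorProduct.includeRight
  { f with
    map_smul' := tensorProduct_map_smul f fun a b m ↦ by
      induction m with
      | zero => rw [smul_zero, f.map_zero, smul_zero]
      | add m m' h h' => rw [smul_add, f.map_add, h, h', f.map_add, smul_add]
      | tmul x ω =>
        rw [tmul_smul_tmul_kaehler_left, tensorKaehlerDesc_tmul_smul]
        simp [f] }

/-- The map `a ⊗ db ↦ (a ⊗ 1) • d(1 ⊗ b)`. -/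
noncomputable def kaehlerOfTensorRight :
    A ⊗[ℤ] KaehlerDifferential ℤ B →ₗ[A ⊗[ℤ] B] KaehlerDifferential ℤ (A ⊗[ℤ] B) :=
  let f : A ⊗[ℤ] KaehlerDifferential ℤ B →+ KaehlerDifferential ℤ (A ⊗[ℤ] B) :=
    tensorKaehlerDesc Algebra.TensorProduct.includeRight
      Algebra.TensorProduct.includeLeft
  { f with
    map_smul' := tensorProduct_map_smul f fun a b m ↦ by
      induction m with
      | zero => rw [smul_zero, f.map_zero, smul_zero]
      | add m m' h h' => rw [smul_add, f.map_add, h, h', f.map_add, smul_add]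
      | tmul x ω =>
        rw [tmul_smul_tmul_kaehler_right, tensorKaehlerDesc_tmul_smul]
        simp [f] }

variable {A B}

theorem tensorDerivationLeft_tmul (a : A) (b : B) :
    tensorDerivationLeft A B (a ⊗ₜ b) = b ⊗ₜ KaehlerDifferential.D ℤ A a :=
  rfl

theorem tensorDerivationRight_tmul (a : A) (b : B) :
    tensorDerivationRight A B (a ⊗ₜ b) = a ⊗ₜ KaehlerDifferential.D ℤ B b :=
  rfl

theorem kaehlerOfTensorLeft_tmul_D (b : B) (a : A) :
    kaehlerOfTensorLeft A B (b ⊗ₜ KaehlerDifferential.D ℤ A a) =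
      ((1 : A) ⊗ₜ[ℤ] b) • KaehlerDifferential.D ℤ (A ⊗[ℤ] B) (a ⊗ₜ 1) :=
  tensorKaehlerDesc_tmul_D _ _ b a

theorem kaehlerOfTensorRight_tmul_D (a : A) (b : B) :
    kaehlerOfTensorRight A B (a ⊗ₜ KaehlerDifferential.D ℤ B b) =
      (a ⊗ₜ[ℤ] (1 : B)) • KaehlerDifferential.D ℤ (A ⊗[ℤ] B) (1 ⊗ₜ b) :=
  tensorKaehlerDesc_tmul_D _ _ a b

theorem kaehlerOfTensor_tensorDerivation (c : A ⊗[ℤ] B) :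
    kaehlerOfTensorLeft A B (tensorDerivationLeft A B c) +
      kaehlerOfTensorRight A B (tensorDerivationRight A B c) =
    KaehlerDifferential.D ℤ (A ⊗[ℤ] B) c := by
  induction c with
  | zero => simp only [map_zero, add_zero]
  | add x y hx hy =>
    rw [map_add, map_add, map_add, map_add, map_add, ← hx, ← hy]
    abel
  | tmul a b =>
    have hab : a ⊗ₜ[ℤ] b = (a ⊗ₜ[ℤ] (1 : B)) * ((1 : A) ⊗ₜ[ℤ] b) := by simp
    rw [tensorDerivationLeft_tmul, tensorDerivationRight_tmul, kaehlerOfTensorLeft_tmul_D,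
      kaehlerOfTensorRight_tmul_D, hab, Derivation.leibniz, add_comm]

theorem top_le_span_tensorDerivationLeft :
    ⊤ ≤ Submodule.span (A ⊗[ℤ] B)
      (tensorDerivationLeft A B '' {c | tensorDerivationRight A B c = 0}) := by
  rintro m -
  induction m with
  | zero => exact zero_mem _
  | add m m' h h' => exact add_mem h h'
  | tmul b ω =>
    induction ω using KaehlerDifferential.induction_smul_D with
    | zero => rw [TensorProduct.tmul_zero]; exact zero_mem _
    | add ω η h h' => rw [TensorProduct.tmul_add]; exact add_mem h h'
    | smul_D a a' =>
      rw [← mul_one b, ← tmul_smul_tmul_kaehler_left]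
      refine Submodule.smul_mem _ _ (Submodule.subset_span ⟨a' ⊗ₜ 1, ?_, rfl⟩)
      rw [Set.mem_ofPred_eq, tensorDerivationRight_tmul, Derivation.map_one_eq_zero,
        TensorProduct.tmul_zero]

theorem top_le_span_tensorDerivationRight :
    ⊤ ≤ Submodule.span (A ⊗[ℤ] B)
      (tensorDerivationRight A B '' {c | tensorDerivationLeft A B c = 0}) := by
  rintro m -
  induction m with
  | zero => exact zero_mem _
  | add m m' h h' => exact add_mem h h'
  | tmul a ω =>
    induction ω using KaehlerDifferential.induction_smul_D with
    | zero => rw [TensorProduct.tmul_zero]; exact zero_mem _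
    | add ω η h h' => rw [TensorProduct.tmul_add]; exact add_mem h h'
    | smul_D b b' =>
      rw [← mul_one a, ← tmul_smul_tmul_kaehler_right]
      refine Submodule.smul_mem _ _ (Submodule.subset_span ⟨1 ⊗ₜ b', ?_, rfl⟩)
      rw [Set.mem_ofPred_eq, tensorDerivationLeft_tmul, Derivation.map_one_eq_zero,
        TensorProduct.tmul_zero]

variable (A B)

/-- The decomposition `Ω[(A ⊗ B)⁄ℤ] ≃ (B ⊗ Ω[A⁄ℤ]) × (A ⊗ Ω[B⁄ℤ])`. -/
noncomputable def kaehlerTensorEquiv :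
    KaehlerDifferential ℤ (A ⊗[ℤ] B) ≃ₗ[A ⊗[ℤ] B]
      (B ⊗[ℤ] KaehlerDifferential ℤ A) × (A ⊗[ℤ] KaehlerDifferential ℤ B) :=
  haveI := isScalarTower_int_of_algebra (C := A ⊗[ℤ] B) (M := B ⊗[ℤ] KaehlerDifferential ℤ A)
  haveI := isScalarTower_int_of_algebra (C := A ⊗[ℤ] B) (M := A ⊗[ℤ] KaehlerDifferential ℤ B)
  KaehlerDifferential.equivProdOfDerivations (tensorDerivationLeft A B) (tensorDerivationRight A B)
    (kaehlerOfTensorLeft A B) (kaehlerOfTensorRight A B) kaehlerOfTensor_tensorDerivation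
    top_le_span_tensorDerivationLeft top_le_span_tensorDerivationRight

end

/-- For commutative rings `A` and `B`, there is an isomorphism of
`(A ⊗[ℤ] B)`-modules `Ω[(A ⊗[ℤ] B)⁄ℤ] ≅ (B ⊗[ℤ] Ω[A⁄ℤ]) × (A ⊗[ℤ] Ω[B⁄ℤ])`, where the
two factors carry their natural `(A ⊗[ℤ] B)`-module structures (`a ⊗ b` acting by
multiplication by the scalar from the other factor on the ring component and by the
scalar action on the Kähler differentials). -/
theorem kaehler_of_tensorProduct (A B : Type*) [CommRing A] [CommRing B] :
    letI := tensorKaehlerModuleLeft A B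
    letI := tensorKaehlerModuleRight A B
    (∀ (a : A) (b x : B) (ω : KaehlerDifferential ℤ A),
        (a ⊗ₜ[ℤ] b) • (x ⊗ₜ[ℤ] ω) = (b * x) ⊗ₜ[ℤ] (a • ω)) ∧
    (∀ (a x : A) (b : B) (ω : KaehlerDifferential ℤ B),
        (a ⊗ₜ[ℤ] b) • (x ⊗ₜ[ℤ] ω) = (a * x) ⊗ₜ[ℤ] (b • ω)) ∧
    Nonempty
      (KaehlerDifferential ℤ (A ⊗[ℤ] B) ≃ₗ[A ⊗[ℤ] B]
        (B ⊗[ℤ] KaehlerDifferential ℤ A) × (A ⊗[ℤ] KaehlerDifferential ℤ B)) :=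
  ⟨tmul_smul_tmul_kaehler_left, tmul_smul_tmul_kaehler_right, ⟨kaehlerTensorEquiv A B⟩⟩
end
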